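/- Suppose p ∈ (0,1] and q ∈ [0,1) satisfy max{p, 1−q} ≥ θ/n for a constant θ > 0, and consider a random matching algorithm satisfying the F-fair condition on an edge-Markovian evolving graph with parameters p, q, with initial discrepancy Δ ≥ 2. Let 0 < ε < 1/4 and let T_2 be any integer with T_2 ≥ (54·r/(c_*·F))·log(Δ·n/ε). Then: (i) if min_{v∈V} Γ_0(v) ≥ μ − 1, then Pr[ max_{v∈V} Γ_{T_2}(v) ≤ ⌈μ⌋ + 1 ] ≥ 1 − ε²; and (ii) if min_{v∈V} Γ̄_0(v) ≥ μ̄ − 1 (where Γ̄_t(v) := K − Γ_t(v) and μ̄ := K − μ), then Pr[ max_{v∈V} Γ̄_{T_2}(v) ≤ ⌈μ̄⌋ + 1 ] ≥ 1 − ε². -/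

import Mathlib

open Finset

noncomputable section

/-- Rounding a real number to the nearest integer, ties rounded up: `⌈x⌋ := ⌈x - 1/2⌉`. -/
def roundNear (x : ℝ) : ℤ := ⌈x - 1 / 2⌉

/-- The degree of a vertex in a simple graph (stated without decidability assumptions). -/
def gdeg {V : Type} (G : SimpleGraph V) (v : V) : ℕ := Nat.card {u : V // G.Adj v u}

/-- The initial discrepancy `Δ = max Γ₀ - min Γ₀` of a load configuration. -/
def disc {V : Type} [Fintype V] [Nonempty V] (Γ₀ : V → ℕ) : ℕ :=
  Finset.univ.sup Γ₀ - Finset.univ.inf' Finset.univ_nonempty Γ₀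

/-- An execution of a random matching load-balancing algorithm on an edge-Markovian
evolving graph with parameters `p, q` on the vertex set `V`:
* `G t` is the (random) graph at time `t`, `M t` the random matching chosen at time `t`,
  and `Γ t` the load configuration at time `t`;
* `hist t` is the σ-algebra of events determined by the history
  `Γ_0, G_0, M_0, Γ_1, …, G_{t-1}, M_{t-1}, Γ_t` of the execution up to time `t`;
* conditionally on any (positive-probability) event determined by the history up to time `t+1`
  which determines `G t = H`, every non-edge of `H` becomes an edge of `G (t+1)` with
  probability `p`, every edge of `H` disappears with probability `q`, independently over pairs;
* for every matched pair `{v,u}` of `M t`, the loads are rebalanced to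
  `(⌈(Γ t v + Γ t u)/2⌉, ⌊(Γ t v + Γ t u)/2⌋)` or the transposed pair (each with
  probability `1/2`, which only matters when `Γ t v + Γ t u` is odd), while
  unmatched vertices keep their loads. -/
structure EMLoadProcess (V : Type) [Fintype V] [DecidableEq V] where
  Ω : Type
  [mΩ : MeasurableSpace Ω]
  μ : MeasureTheory.Measure Ω
  isProb : MeasureTheory.IsProbabilityMeasure μ
  p : ℝ
  q : ℝ
  p_pos : 0 < p
  p_le_one : p ≤ 1
  q_nonneg : 0 ≤ q
  q_lt_one : q < 1
  G : ℕ → Ω → SimpleGraph V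
  M : ℕ → Ω → Set (Sym2 V)
  Γ : ℕ → Ω → V → ℕ
  hist : ℕ → MeasurableSpace Ω
  hist_le : ∀ t, hist t ≤ mΩ
  hist_mono : Monotone hist
  meas_Γ : ∀ t, @Measurable Ω (V → ℕ) (hist t) ⊤ (Γ t)
  meas_G : ∀ t, @Measurable Ω (SimpleGraph V) (hist (t + 1)) ⊤ (G t)
  meas_M : ∀ t, @Measurable Ω (Set (Sym2 V)) (hist (t + 1)) ⊤ (M t)
  M_sub : ∀ t ω, M t ω ⊆ (G t ω).edgeSet
  M_matching : ∀ t ω, ∀ e ∈ M t ω, ∀ f ∈ M t ω, ∀ x : V, x ∈ e → x ∈ f → e = f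
  unmatched : ∀ t ω v, (∀ u : V, s(v, u) ∉ M t ω) → Γ (t + 1) ω v = Γ t ω v
  matched : ∀ t ω v u, s(v, u) ∈ M t ω →
    (Γ (t + 1) ω v = (Γ t ω v + Γ t ω u + 1) / 2 ∧ Γ (t + 1) ω u = (Γ t ω v + Γ t ω u) / 2) ∨
    (Γ (t + 1) ω v = (Γ t ω v + Γ t ω u) / 2 ∧ Γ (t + 1) ω u = (Γ t ω v + Γ t ω u + 1) / 2)
  coin : ∀ (t : ℕ) (v u : V) (E : Set Ω),
    @MeasurableSet _ (hist t ⊔ MeasurableSpace.comap (G t) ⊤ ⊔ MeasurableSpace.comap (M t) ⊤) E →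
    μ E ≠ 0 → E ⊆ {ω | s(v, u) ∈ M t ω ∧ Odd (Γ t ω v + Γ t ω u)} →
    ProbabilityTheory.cond μ E {ω | Γ (t + 1) ω v = (Γ t ω v + Γ t ω u + 1) / 2} = 1 / 2
  markov_edge : ∀ (t : ℕ) (H : SimpleGraph V) (E : Set Ω), @MeasurableSet _ (hist (t + 1)) E →
    μ E ≠ 0 → E ⊆ {ω | G t ω = H} → ∀ e : Sym2 V, ¬e.IsDiag → e ∈ H.edgeSet →
    ProbabilityTheory.cond μ E {ω | e ∈ (G (t + 1) ω).edgeSet} = ENNReal.ofReal (1 - q)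
  markov_nonedge : ∀ (t : ℕ) (H : SimpleGraph V) (E : Set Ω), @MeasurableSet _ (hist (t + 1)) E →
    μ E ≠ 0 → E ⊆ {ω | G t ω = H} → ∀ e : Sym2 V, ¬e.IsDiag → e ∉ H.edgeSet →
    ProbabilityTheory.cond μ E {ω | e ∈ (G (t + 1) ω).edgeSet} = ENNReal.ofReal p
  markov_indep : ∀ (t : ℕ) (H : SimpleGraph V) (E : Set Ω), @MeasurableSet _ (hist (t + 1)) E →
    μ E ≠ 0 → E ⊆ {ω | G t ω = H} →
    ProbabilityTheory.iIndepSet (fun e : {e : Sym2 V // ¬e.IsDiag} => {ω | (e : Sym2 V) ∈ (G (t + 1) ω).edgeSet})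
      (ProbabilityTheory.cond μ E)

/-- The `F`-fair condition: conditionally on `G t = Gr` and any (positive-probability) event
determined by the history of the execution up to time `t`, every edge `{u,v}` of `Gr` is matched
with probability at least `F / max (deg u) (deg v)`. -/
def EMLoadProcess.Fair {V : Type} [Fintype V] [DecidableEq V]
    (P : EMLoadProcess V) (F : ℝ) : Prop :=
  ∀ (t : ℕ) (Gr : SimpleGraph V) (u v : V), Gr.Adj u v →
    ∀ E : Set P.Ω, @MeasurableSet _ (P.hist t) E →
      P.μ ({ω | P.G t ω = Gr} ∩ E) ≠ 0 →
      ENNReal.ofReal (F / (max (gdeg Gr u) (gdeg Gr v) : ℝ)) ≤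
        ProbabilityTheory.cond P.μ ({ω | P.G t ω = Gr} ∩ E) {ω | s(u, v) ∈ P.M t ω}

/-- The ratio `r := max{p/(1−q), (1−q)/p}` of an edge-Markovian evolving graph. -/
def EMLoadProcess.r {V : Type} [Fintype V] [DecidableEq V] (P : EMLoadProcess V) : ℝ :=
  max (P.p / (1 - P.q)) ((1 - P.q) / P.p)

/-- The average load `μ = (Σ_v Γ₀(v))/n` of a configuration `Γ₀`. -/
def avgLoad {V : Type} [Fintype V] (Γ₀ : V → ℕ) : ℝ :=
  (∑ v : V, (Γ₀ v : ℝ)) / (Fintype.card V : ℝ)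

/-- The constant `c_* = (1 − e^{−θ/3})²/(2 + 1/θ)`. -/
noncomputable def cstar (θ : ℝ) : ℝ := (1 - Real.exp (-θ / 3)) ^ 2 / (2 + 1 / θ)

/-- The squared excess of a load `x` over the level `m + 1`. -/
def sqExcess (m x : ℤ) : ℕ := (x - m - 1).toNat ^ 2

lemma sqExcess_eq_zero_iff {m x : ℤ} : sqExcess m x = 0 ↔ x ≤ m + 1 := by
  simp only [sqExcess, ne_eq, OfNat.ofNat_ne_zero, not_false_eq_true, pow_eq_zero_iff]
  omega

lemma sqExcess_add_le {m a b c d : ℤ} (hs : a + b = c + d) (hd : |a - b| ≤ 1) :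
    sqExcess m a + sqExcess m b ≤ sqExcess m c + sqExcess m d := by
  unfold sqExcess
  zify
  simp only [Int.ofNat_toNat]
  rw [abs_le] at hd
  wlog hab : b ≤ a generalizing a b
  · have := this (a := b) (b := a) (by omega) (by omega) (by omega)
    omega
  wlog hcd : d ≤ c generalizing c d
  · have := this (c := d) (d := c) (by omega) (by omega)
    omega
  have h1 : a ≤ c := by omega
  obtain ⟨k, rfl⟩ : ∃ k, c = a + k := ⟨c - a, by ring⟩
  obtain rfl : d = b - k := by omega
  have hk : 0 ≤ k := by omega
  rcases le_total (a - m - 1) 0 with ha | ha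
  · rw [max_eq_right ha, max_eq_right (by omega : b - m - 1 ≤ 0)]
    positivity
  · rw [max_eq_left ha, max_eq_left (by omega : 0 ≤ a + k - m - 1)]
    rcases le_total (b - m - 1) 0 with hb | hb
    · rw [max_eq_right hb, max_eq_right (by omega : b - k - m - 1 ≤ 0)]
      nlinarith
    · rw [max_eq_left hb]
      rcases le_total (b - k - m - 1) 0 with hbk | hbk
      · rw [max_eq_right hbk]
        nlinarith
      · rw [max_eq_left hbk]
        nlinarith

lemma two_mul_sqExcess_add_le {m a b c d : ℤ} (hs : a + b = c + d) (hd : |a - b| ≤ 1)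
    (hm : d ≤ m) : 2 * (sqExcess m a + sqExcess m b) ≤ sqExcess m c := by
  unfold sqExcess
  zify
  simp only [Int.ofNat_toNat]
  rw [abs_le] at hd
  wlog hab : b ≤ a generalizing a b
  · have := this (a := b) (b := a) (by omega) (by omega) (by omega)
    omega
  rcases le_total (a - m - 1) 0 with ha | ha
  · rw [max_eq_right ha, max_eq_right (by omega : b - m - 1 ≤ 0)]
    positivity
  · rcases ha.eq_or_lt with ha | ha
    · rw [← ha, max_eq_right (by omega : b - m - 1 ≤ 0)]
      simp only [max_self]
      positivity
    · rw [max_eq_left ha.le, max_eq_left (by omega : 0 ≤ b - m - 1),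
        max_eq_left (by omega : 0 ≤ c - m - 1)]
      have key : ∀ a' b' c' : ℤ, 0 ≤ b' → b' ≤ a' → a' ≤ b' + 1 → a' + b' + 1 ≤ c' →
          2 * (a' ^ 2 + b' ^ 2) ≤ c' ^ 2 := fun a' b' c' h1 h2 h3 h4 => by
        nlinarith [mul_self_le_mul_self (by omega : 0 ≤ a' + b' + 1) h4]
      exact key _ _ _ (by omega) (by omega) (by omega) (by omega)

/-- Balancing the two loads of every edge of the matching `M` turns the loads `x` into the second
configuration. -/
structure IsBalancingStep {V : Type} (M : Set (Sym2 V)) (x x' : V → ℤ) : Prop where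
  irrefl : ∀ v, s(v, v) ∉ M
  unique : ∀ v u w, s(v, u) ∈ M → s(v, w) ∈ M → u = w
  unmatched : ∀ v, (∀ u, s(v, u) ∉ M) → x' v = x v
  sum_eq : ∀ v u, s(v, u) ∈ M → x' v + x' u = x v + x u
  diff_le : ∀ v u, s(v, u) ∈ M → |x' v - x' u| ≤ 1

namespace IsBalancingStep

variable {V : Type} {M : Set (Sym2 V)} {x x' : V → ℤ}

lemma exists_partner (h : IsBalancingStep M x x') :
    ∃ σ : Equiv.Perm V, (∀ v, σ (σ v) = v) ∧ (∀ v u, s(v, u) ∈ M ↔ σ v = u ∧ σ v ≠ v) := by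
  classical
  let σ : V → V := fun v => if hv : ∃ u, s(v, u) ∈ M then hv.choose else v
  have hσ : ∀ v u, s(v, u) ∈ M → σ v = u := by
    intro v u hu
    have hv : ∃ u, s(v, u) ∈ M := ⟨u, hu⟩
    simp only [σ, dif_pos hv]
    exact h.unique v _ _ hv.choose_spec hu
  have hM : ∀ v, σ v ≠ v → s(v, σ v) ∈ M := by
    intro v hv
    by_cases hu : ∃ u, s(v, u) ∈ M
    · obtain ⟨u, hu⟩ := hu
      rwa [hσ v u hu]
    · exact absurd (by simp only [σ, dif_neg hu]) hv
  have hinv : Function.Involutive σ := by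
    intro v
    by_cases hv : σ v = v
    · rw [hv, hv]
    · exact hσ _ _ (Sym2.eq_swap ▸ hM v hv)
  refine ⟨hinv.toPerm, hinv, fun v u => ⟨fun hu => ⟨hσ v u hu, fun hv => ?_⟩, ?_⟩⟩
  · have h1 : σ v = v := hv
    rw [← hσ v u hu, h1] at hu
    exact h.irrefl v hu
  · rintro ⟨rfl, hv⟩
    exact hM v hv

lemma sum_preserved [Fintype V] (h : IsBalancingStep M x x') : ∑ v, x' v = ∑ v, x v := by
  obtain ⟨σ, -, hσ⟩ := h.exists_partner
  have h1 : ∀ y : V → ℤ, 2 * ∑ v, y v = ∑ v, (y v + y (σ v)) := fun y => by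
    rw [Finset.sum_add_distrib, Equiv.sum_comp σ y, two_mul]
  have h2 : ∑ v, (x' v + x' (σ v)) = ∑ v, (x v + x (σ v)) := by
    refine Finset.sum_congr rfl fun v _ => ?_
    by_cases hv : σ v = v
    · rw [hv, h.unmatched v fun u hu => ((hσ v u).1 hu).2 hv]
    · exact h.sum_eq _ _ ((hσ v _).2 ⟨rfl, hv⟩)
  linarith [h1 x, h1 x']

lemma lower_bound (h : IsBalancingStep M x x') {l : ℤ} (hl : ∀ v, l ≤ x v) (v : V) :
    l ≤ x' v := by
  by_cases hv : ∃ u, s(v, u) ∈ M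
  · obtain ⟨u, hu⟩ := hv
    have h1 := h.sum_eq v u hu
    have h2 := abs_le.1 (h.diff_le v u hu)
    have := hl v
    have := hl u
    omega
  · rw [h.unmatched v fun u hu => hv ⟨u, hu⟩]
    exact hl v

open Classical in
lemma potential_drop [Fintype V] (h : IsBalancingStep M x x') (m : ℤ) :
    2 * ∑ v, sqExcess m (x' v) +
      ∑ v, ∑ u, (if x u ≤ m ∧ s(v, u) ∈ M then sqExcess m (x v) else 0) ≤
    2 * ∑ v, sqExcess m (x v) := by
  obtain ⟨σ, hinv, hσ⟩ := h.exists_partner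
  let A : V → ℕ := fun v => if x (σ v) ≤ m ∧ σ v ≠ v then sqExcess m (x v) else 0
  have hA : ∀ v, ∑ u, (if x u ≤ m ∧ s(v, u) ∈ M then sqExcess m (x v) else 0) = A v := by
    intro v
    rw [Finset.sum_eq_single (σ v)]
    · simp only [A, hσ, true_and]
    · intro u _ hu
      rw [if_neg]
      rintro ⟨-, hM⟩
      exact hu ((hσ v u).1 hM).1.symm
    · simp
  have hsum : ∀ y : V → ℕ, ∑ v, (y v + y (σ v)) = 2 * ∑ v, y v := fun y => by
    rw [Finset.sum_add_distrib, Equiv.sum_comp σ y, two_mul]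
  have key : ∑ v, (2 * (sqExcess m (x' v) + sqExcess m (x' (σ v))) + (A v + A (σ v))) ≤
      ∑ v, 2 * (sqExcess m (x v) + sqExcess m (x (σ v))) := by
    refine Finset.sum_le_sum fun v _ => ?_
    by_cases hv : σ v = v
    · have h1 : x' v = x v := h.unmatched v fun u hu => ((hσ v u).1 hu).2 hv
      simp [A, hv, h1]
    · have hM := (hσ v _).2 ⟨rfl, hv⟩
      have h1 := h.sum_eq _ _ hM
      have h2 := h.diff_le _ _ hM
      have h3 := sqExcess_add_le (m := m) h1 h2
      have hv' : v ≠ σ v := fun e => hv e.symm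
      simp only [A, hinv, ne_eq, hv, hv', not_false_eq_true, and_true]
      by_cases ha : x (σ v) ≤ m
      · have h4 := two_mul_sqExcess_add_le h1 h2 ha
        have h5 : sqExcess m (x (σ v)) = 0 := sqExcess_eq_zero_iff.2 (by omega)
        rw [h5] at *
        split_ifs <;> omega
      · by_cases hb : x v ≤ m
        · have h4 := two_mul_sqExcess_add_le (h1.trans (add_comm _ _)) h2 hb
          rw [if_neg ha, if_pos hb]
          omega
        · rw [if_neg ha, if_neg hb]
          omega
  rw [Finset.sum_add_distrib, ← Finset.mul_sum, ← Finset.mul_sum, hsum, hsum, hsum] at key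
  simp only [hA]
  omega

end IsBalancingStep

/-- If the loads are at least `m - 1` and exceed `m` by at most `1/2` on average, then a quarter
of the vertices have load at most `m`. -/
lemma card_le_four_mul_card_light {V : Type} [Fintype V] {x : V → ℤ} {m : ℤ}
    (hmin : ∀ v, m - 1 ≤ x v) (hsum : 2 * ∑ v, (x v - m) ≤ Fintype.card V) :
    Fintype.card V ≤ 4 * #{v | x v ≤ m} := by
  have h1 : ∑ v, (1 - 2 * (if x v ≤ m then 1 else 0) : ℤ) ≤ ∑ v, (x v - m) := by
    refine Finset.sum_le_sum fun v _ => ?_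
    have := hmin v
    split_ifs <;> omega
  rw [Finset.sum_sub_distrib, ← Finset.mul_sum, Finset.sum_boole] at h1
  simp only [Finset.sum_const, Finset.card_univ, nsmul_eq_mul, mul_one] at h1
  omega

open MeasureTheory ProbabilityTheory

lemma measureReal_eq_sum_fiber {Ω β : Type*} [MeasurableSpace Ω] [Fintype β] (μ : Measure Ω)
    [IsFiniteMeasure μ] {g : Ω → β} (hg : ∀ b, MeasurableSet (g ⁻¹' {b})) (S : Set Ω) :
    μ.real S = ∑ b, μ.real (g ⁻¹' {b} ∩ S) := by
  have h := sum_measureReal_preimage_singleton (μ := μ.restrict S) Finset.univ fun b _ => hg b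
  simp only [Finset.coe_univ, Set.preimage_univ, measureReal_restrict_apply_univ] at h
  rw [← h]
  exact Finset.sum_congr rfl fun b _ => measureReal_restrict_apply (hg b)

lemma measureReal_inter_eq_mul_cond {Ω : Type*} [MeasurableSpace Ω] (μ : Measure Ω)
    [IsFiniteMeasure μ] {E : Set Ω} (hE : MeasurableSet E) (h0 : μ E ≠ 0) (S : Set Ω) :
    μ.real (E ∩ S) = μ.real E * (cond μ E).real S := by
  simp only [Measure.real, ← ENNReal.toReal_mul]
  rw [cond_apply hE, ENNReal.mul_inv_cancel_left h0 (measure_ne_top μ E)]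

lemma gdeg_eq_sum {V : Type} [Fintype V] (H : SimpleGraph V) [DecidableRel H.Adj] (v : V) :
    (gdeg H v : ℝ) = ∑ w, if H.Adj v w then 1 else 0 := by
  rw [gdeg, Nat.card_eq_fintype_card, Fintype.card_subtype, Finset.sum_boole]

lemma sub_le_disc {V : Type} [Fintype V] [Nonempty V] (Γ₀ : V → ℕ) (v w : V) : (Γ₀ v : ℤ) - Γ₀ w ≤ disc Γ₀ := by
  have h1 : Γ₀ v ≤ Finset.univ.sup Γ₀ := Finset.le_sup (Finset.mem_univ v)
  have h2 : Finset.univ.inf' Finset.univ_nonempty Γ₀ ≤ Γ₀ w :=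
    Finset.inf'_le _ (Finset.mem_univ w)
  unfold disc
  omega

lemma inv_max_ge {a x y : ℝ} (ha : 0 < a) (hx : 0 < x) (hy : 0 < y) :
    2 / a - (x + y) / a ^ 2 ≤ 1 / max x y := by
  have hm : 0 < max x y := lt_max_of_lt_left hx
  have h1 : max x y ≤ x + y := max_le (by linarith) (by linarith)
  have h2 : 2 / a - max x y / a ^ 2 ≤ 1 / max x y := by
    rw [div_sub_div _ _ ha.ne' (by positivity), div_le_div_iff₀ (by positivity) hm]
    nlinarith [mul_nonneg ha.le (sq_nonneg (a - max x y))]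
  have h3 : max x y / a ^ 2 ≤ (x + y) / a ^ 2 := by gcongr
  linarith

namespace EMLoadProcess

variable {V : Type} [Fintype V] [DecidableEq V] (P : EMLoadProcess V)

attribute [local instance] EMLoadProcess.mΩ EMLoadProcess.isProb

/-- The larger of the two one-step edge probabilities. -/
def maxProb : ℝ := max P.p (1 - P.q)

/-- The smaller of the two one-step edge probabilities. -/
def minProb : ℝ := min P.p (1 - P.q)

lemma minProb_pos : 0 < P.minProb := lt_min P.p_pos (by linarith [P.q_lt_one])

lemma minProb_le_maxProb : P.minProb ≤ P.maxProb := min_le_max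

lemma maxProb_pos : 0 < P.maxProb := P.minProb_pos.trans_le P.minProb_le_maxProb

lemma r_eq : P.r = P.maxProb / P.minProb := by
  have h1 := P.p_pos
  have h2 : 0 < 1 - P.q := by linarith [P.q_lt_one]
  unfold r maxProb minProb
  rcases le_total P.p (1 - P.q) with h | h
  · rw [max_eq_right h, min_eq_left h, max_eq_right]
    exact ((div_le_one h2).2 h).trans ((one_le_div h1).2 h)
  · rw [max_eq_left h, min_eq_right h, max_eq_left]
    exact ((div_le_one h1).2 h).trans ((one_le_div h2).2 h)

lemma measurableSet_G_preimage (t : ℕ) (S : Set (SimpleGraph V)) :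
    MeasurableSet (P.G t ⁻¹' S) :=
  P.hist_le _ _ (P.meas_G t (MeasurableSpace.measurableSet_top (s := S)))

lemma measurableSet_M_preimage (t : ℕ) (S : Set (Set (Sym2 V))) :
    MeasurableSet (P.M t ⁻¹' S) :=
  P.hist_le _ _ (P.meas_M t (MeasurableSpace.measurableSet_top (s := S)))

lemma measurableSet_edge (t : ℕ) (e : Sym2 V) : MeasurableSet {ω | e ∈ P.M t ω} :=
  P.measurableSet_M_preimage t {M | e ∈ M}

section Conditioned

variable {t : ℕ} {H : SimpleGraph V} {E : Set P.Ω}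

lemma edge_prob (hE : MeasurableSet[P.hist (t + 1)] E) (h0 : P.μ E ≠ 0)
    (hH : E ⊆ {ω | P.G t ω = H}) {e : Sym2 V} (he : ¬e.IsDiag) :
    P.minProb ≤ (cond P.μ E).real {ω | e ∈ (P.G (t + 1) ω).edgeSet} ∧
      (cond P.μ E).real {ω | e ∈ (P.G (t + 1) ω).edgeSet} ≤ P.maxProb := by
  by_cases heH : e ∈ H.edgeSet
  · rw [Measure.real, P.markov_edge t H E hE h0 hH e he heH,
      ENNReal.toReal_ofReal (by linarith [P.q_lt_one])]
    exact ⟨min_le_right _ _, le_max_right _ _⟩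
  · rw [Measure.real, P.markov_nonedge t H E hE h0 hH e he heH,
      ENNReal.toReal_ofReal P.p_pos.le]
    exact ⟨min_le_left _ _, le_max_left _ _⟩

lemma two_edges_prob (hE : MeasurableSet[P.hist (t + 1)] E) (h0 : P.μ E ≠ 0)
    (hH : E ⊆ {ω | P.G t ω = H}) {u v : V} (huv : u ≠ v) (w : V) :
    (cond P.μ E).real {ω | (P.G (t + 1) ω).Adj u v ∧ (P.G (t + 1) ω).Adj u w} ≤
      (cond P.μ E).real {ω | (P.G (t + 1) ω).Adj u v} *
        (P.maxProb + if w = v then 1 else 0) := by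
  have := cond_isProbabilityMeasure h0
  by_cases hwv : w = v
  · subst hwv
    simp only [and_self, if_true]
    have := P.maxProb_pos
    exact le_mul_of_one_le_right measureReal_nonneg (by linarith)
  rw [if_neg hwv, add_zero]
  by_cases hwu : w = u
  · subst hwu
    simp only [SimpleGraph.irrefl, and_false, Set.ofPred_false, measureReal_empty]
    exact mul_nonneg measureReal_nonneg P.maxProb_pos.le
  have d1 : ¬ (s(u, v)).IsDiag := by simpa using huv
  have d2 : ¬ (s(u, w)).IsDiag := by simpa using Ne.symm hwu
  have hne : (⟨s(u, v), d1⟩ : {e : Sym2 V // ¬e.IsDiag}) ≠ ⟨s(u, w), d2⟩ := by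
    intro h
    have h' := congrArg Subtype.val h
    simp only [Sym2.congr_right] at h'
    exact hwv h'.symm
  have hI := (Indep_iff _ _ _).1
    (((iIndepSet_iff_iIndep _ _).1 (P.markov_indep t H E hE h0 hH)).indep hne) _ _
    (MeasurableSpace.measurableSet_generateFrom (Set.mem_singleton _))
    (MeasurableSpace.measurableSet_generateFrom (Set.mem_singleton _))
  simp only [SimpleGraph.mem_edgeSet] at hI
  have hI' : (cond P.μ E).real {ω | (P.G (t + 1) ω).Adj u v ∧ (P.G (t + 1) ω).Adj u w} =
      (cond P.μ E).real {ω | (P.G (t + 1) ω).Adj u v} *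
        (cond P.μ E).real {ω | (P.G (t + 1) ω).Adj u w} := by
    rw [Measure.real, Measure.real, Measure.real, ← ENNReal.toReal_mul, ← hI]
    rfl
  rw [hI']
  exact mul_le_mul_of_nonneg_left (P.edge_prob hE h0 hH d2).2 measureReal_nonneg

end Conditioned

/-- A lower bound on the conditional probability that a given pair is matched. -/
def matchProb (F : ℝ) : ℝ := F * P.minProb / (2 + 2 * Fintype.card V * P.maxProb)

lemma matchProb_nonneg {F : ℝ} (hF : 0 ≤ F) : 0 ≤ P.matchProb F := by
  have := P.minProb_pos
  have := P.maxProb_pos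
  unfold matchProb
  positivity

lemma fair_measureReal {F : ℝ} (hfair : P.Fair F) {t : ℕ} {Gr : SimpleGraph V}
    {u v : V} (h : Gr.Adj u v) {E : Set P.Ω} (hE : MeasurableSet[P.hist t] E) :
    F / (max (gdeg Gr u) (gdeg Gr v) : ℝ) * P.μ.real (P.G t ⁻¹' {Gr} ∩ E) ≤
      P.μ.real (P.G t ⁻¹' {Gr} ∩ (E ∩ {ω | s(u, v) ∈ P.M t ω})) := by
  have hm : MeasurableSet (P.G t ⁻¹' {Gr} ∩ E) :=
    (P.measurableSet_G_preimage t _).inter (P.hist_le t _ hE)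
  by_cases h0 : P.μ (P.G t ⁻¹' {Gr} ∩ E) = 0
  · rw [Measure.real, h0]
    simp
  have h1 := hfair t Gr u v h E hE h0
  have h2 : F / (max (gdeg Gr u) (gdeg Gr v) : ℝ) ≤
      (cond P.μ (P.G t ⁻¹' {Gr} ∩ E)).real {ω | s(u, v) ∈ P.M t ω} := by
    have := cond_isProbabilityMeasure h0
    rw [Measure.real, ← ENNReal.ofReal_le_iff_le_toReal (measure_ne_top _ _)]
    exact h1
  rw [← Set.inter_assoc, measureReal_inter_eq_mul_cond P.μ hm h0, mul_comm]
  exact mul_le_mul_of_nonneg_left h2 measureReal_nonneg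

open Classical in
lemma matchProb_le_of_subset {F : ℝ} (hF : 0 ≤ F) (hfair : P.Fair F) {t : ℕ}
    {H : SimpleGraph V} {E : Set P.Ω} (hE : MeasurableSet[P.hist (t + 1)] E)
    (hH : E ⊆ {ω | P.G t ω = H}) {u v : V} (huv : u ≠ v) :
    P.matchProb F * P.μ.real E ≤ P.μ.real (E ∩ {ω | s(u, v) ∈ P.M (t + 1) ω}) := by
  by_cases h0 : P.μ E = 0
  · rw [Measure.real, h0]
    simp
  have hEm : MeasurableSet E := P.hist_le _ _ hE
  have hprob := cond_isProbabilityMeasure h0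
  let _ : Fintype (SimpleGraph V) := Fintype.ofFinite _
  set g := P.G (t + 1)
  set ν := cond P.μ E
  have hgm : ∀ b, MeasurableSet (g ⁻¹' {b}) := fun b => P.measurableSet_G_preimage _ _
  have hμν : ∀ S, P.μ.real (E ∩ S) = P.μ.real E * ν.real S := 
    measureReal_inter_eq_mul_cond P.μ hEm h0
  -- probabilities of graph properties as sums over all graphs
  have hQ : ∀ Q : SimpleGraph V → Prop,
      ν.real {ω | Q (g ω)} = ∑ b, (if Q b then 1 else 0) * ν.real (g ⁻¹' {b}) := by
    intro Q
    rw [measureReal_eq_sum_fiber ν hgm]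
    refine Finset.sum_congr rfl fun b _ => ?_
    split_ifs with hb
    · rw [one_mul]
      congr 1
      ext ω
      simp only [Set.mem_inter_iff, Set.mem_preimage, Set.mem_singleton_iff, Set.mem_ofPred_eq,
        and_iff_left_iff_imp]
      rintro rfl
      exact hb
    · rw [zero_mul, ← measureReal_empty (μ := ν)]
      congr 1
      ext ω
      simp only [Set.mem_inter_iff, Set.mem_preimage, Set.mem_singleton_iff, Set.mem_ofPred_eq,
        Set.mem_empty_iff_false, iff_false, not_and]
      rintro rfl
      exact hb
  set a : ℝ := 2 + 2 * Fintype.card V * P.maxProb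
  have hb := P.maxProb_pos
  have ha0 : 0 < a := by positivity
  set e : ℝ := ν.real {ω | (g ω).Adj u v} with he
  have he_lower : P.minProb ≤ e :=
    (P.edge_prob hE h0 hH (e := s(u, v)) (by simpa using huv)).1
  -- the expected degree of an endpoint on the event that the edge is present
  have hdeg : ∀ x y, x ≠ y → ν.real {ω | (g ω).Adj x y} = e →
      ∑ b : SimpleGraph V, (if b.Adj x y then (gdeg b x : ℝ) else 0) * ν.real (g ⁻¹' {b}) ≤
        e * (a / 2) := by
    intro x y hxy hexy
    calc _ = ∑ b : SimpleGraph V, ∑ w,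
          (if b.Adj x y ∧ b.Adj x w then 1 else 0) * ν.real (g ⁻¹' {b}) := by
          refine Finset.sum_congr rfl fun b _ => ?_
          rw [← Finset.sum_mul, gdeg_eq_sum]
          by_cases hb : b.Adj x y <;> simp [hb]
      _ = ∑ w, ν.real {ω | (g ω).Adj x y ∧ (g ω).Adj x w} := by
          rw [Finset.sum_comm]
          exact Finset.sum_congr rfl fun w _ => by
            rw [hQ fun b => b.Adj x y ∧ b.Adj x w]
            exact Finset.sum_congr rfl fun b _ => by congr
      _ ≤ ∑ w, e * (P.maxProb + if w = y then 1 else 0) := by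
          rw [← hexy]
          exact Finset.sum_le_sum fun w _ => P.two_edges_prob hE h0 hH hxy w
      _ = e * (a / 2) := by
          rw [← Finset.mul_sum, Finset.sum_add_distrib, Finset.sum_ite_eq']
          simp only [Finset.sum_const, Finset.card_univ, nsmul_eq_mul, Finset.mem_univ, if_true, a]
          ring
  have hu := hdeg u v huv rfl
  have hv := hdeg v u huv.symm (by rw [he]; simp only [SimpleGraph.adj_comm])
  have hfairν : ∀ b : SimpleGraph V,
      F * (2 / a * ((if b.Adj u v then 1 else 0) * ν.real (g ⁻¹' {b})) -
        1 / a ^ 2 * ((if b.Adj u v then (gdeg b u : ℝ) else 0) * ν.real (g ⁻¹' {b}) +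
          (if b.Adj v u then (gdeg b v : ℝ) else 0) * ν.real (g ⁻¹' {b}))) ≤
      ν.real (g ⁻¹' {b} ∩ {ω | s(u, v) ∈ P.M (t + 1) ω}) := by
    intro b
    by_cases hadj : b.Adj u v
    · have hpos : ∀ x y, b.Adj x y → 0 < (gdeg b x : ℝ) := fun x y hxy => by
        have : Nonempty {w // b.Adj x w} := ⟨⟨y, hxy⟩⟩
        exact Nat.cast_pos.2 Nat.card_pos
      have h1 := P.fair_measureReal hfair hadj hE
      have h2 := inv_max_ge ha0 (hpos u v hadj) (hpos v u hadj.symm)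
      have h3 : F / max (gdeg b u : ℝ) (gdeg b v) * ν.real (g ⁻¹' {b}) ≤
          ν.real (g ⁻¹' {b} ∩ {ω | s(u, v) ∈ P.M (t + 1) ω}) := by
        have h4 : 0 < P.μ.real E := ENNReal.toReal_pos h0 (measure_ne_top _ _)
        rw [Set.inter_comm, hμν, Set.inter_left_comm, hμν] at h1
        refine le_of_mul_le_mul_left ?_ h4
        linarith
      refine le_trans ?_ h3
      simp only [hadj, hadj.symm, if_true]
      calc _ = F * (2 / a - ((gdeg b u : ℝ) + gdeg b v) / a ^ 2) * ν.real (g ⁻¹' {b}) := by ring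
        _ ≤ F * (1 / max (gdeg b u : ℝ) (gdeg b v)) * ν.real (g ⁻¹' {b}) := by gcongr
        _ = _ := by ring
    · have hadj' : ¬ b.Adj v u := fun h => hadj h.symm
      simp [hadj, hadj']
  have htotal := Finset.sum_le_sum fun b (_ : b ∈ Finset.univ) => hfairν b
  rw [← measureReal_eq_sum_fiber ν hgm, ← Finset.mul_sum, Finset.sum_sub_distrib,
    ← Finset.mul_sum, ← Finset.mul_sum, Finset.sum_add_distrib, ← hQ fun b => b.Adj u v] at htotal
  rw [hμν, mul_comm]
  refine mul_le_mul_of_nonneg_left (le_trans ?_ htotal) measureReal_nonneg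
  rw [matchProb, mul_div_assoc]
  refine mul_le_mul_of_nonneg_left ?_ hF
  calc P.minProb / a ≤ e / a := by gcongr
    _ = 2 / a * e - 1 / a ^ 2 * (e * (a / 2) + e * (a / 2)) := by
        field_simp
        ring
    _ ≤ _ := by gcongr

lemma matchProb_le {F : ℝ} (hF : 0 ≤ F) (hfair : P.Fair F) {t : ℕ} {E : Set P.Ω}
    (hE : MeasurableSet[P.hist (t + 1)] E) {u v : V} (huv : u ≠ v) :
    P.matchProb F * P.μ.real E ≤ P.μ.real (E ∩ {ω | s(u, v) ∈ P.M (t + 1) ω}) := by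
  let _ : Fintype (SimpleGraph V) := Fintype.ofFinite _
  have hgm : ∀ b, MeasurableSet (P.G t ⁻¹' {b}) := fun b => P.measurableSet_G_preimage _ _
  rw [measureReal_eq_sum_fiber P.μ hgm, measureReal_eq_sum_fiber P.μ hgm (E ∩ _), Finset.mul_sum]
  refine Finset.sum_le_sum fun b _ => ?_
  rw [← Set.inter_assoc]
  refine P.matchProb_le_of_subset hF hfair (H := b) ?_ (fun ω hω => hω.1) huv
  exact MeasurableSet.inter (P.meas_G t MeasurableSpace.measurableSet_top) hE

lemma measurable_loads (t : ℕ) : Measurable[P.hist t] (P.Γ t) :=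
  (P.meas_Γ t).mono le_rfl le_top

lemma lintegral_matched_ge {F : ℝ} (hF : 0 ≤ F) (hfair : P.Fair F) (t : ℕ) {u v : V}
    (huv : u ≠ v) (g : (V → ℕ) → ENNReal) :
    ENNReal.ofReal (P.matchProb F) * ∫⁻ ω, g (P.Γ (t + 1) ω) ∂P.μ ≤
      ∫⁻ ω in {ω | s(u, v) ∈ P.M (t + 1) ω}, g (P.Γ (t + 1) ω) ∂P.μ := by
  have hm : Measurable (P.Γ (t + 1)) := (P.measurable_loads (t + 1)).mono (P.hist_le _) le_rfl
  have hg : Measurable g := Measurable.of_discrete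
  rw [← lintegral_map hg hm, ← lintegral_map hg hm, ← smul_eq_mul, ← lintegral_smul_measure]
  refine lintegral_mono' (Measure.le_iff.2 fun S hS => ?_) le_rfl
  rw [Measure.smul_apply, Measure.map_apply hm hS, Measure.map_apply hm hS,
    Measure.restrict_apply (hm hS), smul_eq_mul]
  have h := P.matchProb_le hF hfair (P.measurable_loads (t + 1) hS) huv
  rw [← ENNReal.ofReal_toReal (measure_ne_top P.μ (P.Γ (t + 1) ⁻¹' S)),
    ← ENNReal.ofReal_mul (P.matchProb_nonneg hF)]
  exact ENNReal.ofReal_le_of_le_toReal h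

/-- The loads after a change of sign `σ` and a shift by `d`. -/
def affineLoad (σ d : ℤ) (γ : V → ℕ) (v : V) : ℤ := σ * γ v + d

lemma isBalancingStep {σ : ℤ} (hσ : σ = 1 ∨ σ = -1) (d : ℤ) (t : ℕ) (ω : P.Ω) :
    IsBalancingStep (P.M t ω) (affineLoad σ d (P.Γ t ω)) (affineLoad σ d (P.Γ (t + 1) ω)) where
  irrefl v hv := (P.G t ω).irrefl (P.M_sub t ω hv)
  unique v u w hu hw := by
    have := P.M_matching t ω _ hu _ hw v (Sym2.mem_mk_left _ _) (Sym2.mem_mk_left _ _)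
    exact Sym2.congr_right.1 this
  unmatched v hv := by simp only [affineLoad, P.unmatched t ω v hv]
  sum_eq v u hu := by
    have := P.matched t ω v u hu
    simp only [affineLoad]
    rcases hσ with rfl | rfl <;> omega
  diff_le v u hu := by
    have := P.matched t ω v u hu
    simp only [affineLoad]
    rw [abs_le]
    rcases hσ with rfl | rfl <;> omega

/-- The total squared excess of a load configuration over the level `m + 1`. -/
def potential (m : ℤ) (x : V → ℤ) : ℕ := ∑ v, sqExcess m (x v)

lemma potential_le_initial {σ : ℤ} (hσ : σ = 1 ∨ σ = -1) (d m : ℤ) (t : ℕ) (ω : P.Ω) :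
    potential m (affineLoad σ d (P.Γ t ω)) ≤ potential m (affineLoad σ d (P.Γ 0 ω)) := by
  induction t with
  | zero => rfl
  | succ t ih =>
    refine le_trans ?_ ih
    have := (P.isBalancingStep hσ d t ω).potential_drop m
    unfold potential
    omega

lemma card_le_four_mul_card_light {σ : ℤ} (hσ : σ = 1 ∨ σ = -1) (d m : ℤ) (ω : P.Ω)
    (hmin : ∀ v, m - 1 ≤ affineLoad σ d (P.Γ 0 ω) v)
    (hsum : 2 * ∑ v, (affineLoad σ d (P.Γ 0 ω) v - m) ≤ Fintype.card V) (t : ℕ) :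
    Fintype.card V ≤ 4 * #{v | affineLoad σ d (P.Γ t ω) v ≤ m} := by
  have h : (∀ v, m - 1 ≤ affineLoad σ d (P.Γ t ω) v) ∧
      ∑ v, affineLoad σ d (P.Γ t ω) v = ∑ v, affineLoad σ d (P.Γ 0 ω) v := by
    induction t with
    | zero => exact ⟨hmin, rfl⟩
    | succ t ih =>
      have hstep := P.isBalancingStep hσ d t ω
      exact ⟨hstep.lower_bound ih.1, hstep.sum_preserved.trans ih.2⟩
  refine _root_.card_le_four_mul_card_light h.1 ?_
  rwa [Finset.sum_sub_distrib, h.2, ← Finset.sum_sub_distrib]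

lemma lintegral_potential_drift {F : ℝ} (hF : 0 ≤ F) (hfair : P.Fair F) {σ : ℤ}
    (hσ : σ = 1 ∨ σ = -1) (d m : ℤ) (t : ℕ)
    (hlight : ∀ ω, Fintype.card V ≤ 4 * #{v | affineLoad σ d (P.Γ (t + 1) ω) v ≤ m}) :
    8 * ∫⁻ ω, (potential m (affineLoad σ d (P.Γ (t + 2) ω)) : ENNReal) ∂P.μ +
      ENNReal.ofReal (P.matchProb F) * Fintype.card V *
        ∫⁻ ω, (potential m (affineLoad σ d (P.Γ (t + 1) ω)) : ENNReal) ∂P.μ ≤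
    8 * ∫⁻ ω, (potential m (affineLoad σ d (P.Γ (t + 1) ω)) : ENNReal) ∂P.μ := by
  classical
  have hm : ∀ t, Measurable (P.Γ t) := fun t => (P.measurable_loads t).mono (P.hist_le _) le_rfl
  have hmeas : ∀ (t : ℕ) (g : (V → ℕ) → ENNReal), Measurable fun ω => g (P.Γ t ω) :=
    fun t g => Measurable.of_discrete.comp (hm t)
  set κ := ENNReal.ofReal (P.matchProb F)
  let x : P.Ω → V → ℤ := fun ω => affineLoad σ d (P.Γ (t + 1) ω)
  -- the contribution of the pair `v, u` when `u` is light
  let g : V → V → (V → ℕ) → ENNReal := fun v u γ =>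
    if affineLoad σ d γ u ≤ m then (sqExcess m (affineLoad σ d γ v) : ENNReal) else 0
  have hpair : ∀ v u, κ * ∫⁻ ω, g v u (P.Γ (t + 1) ω) ∂P.μ ≤
      ∫⁻ ω, {ω | s(v, u) ∈ P.M (t + 1) ω}.indicator (fun ω => g v u (P.Γ (t + 1) ω)) ω ∂P.μ := by
    intro v u
    rw [lintegral_indicator (P.measurableSet_edge _ _)]
    rcases eq_or_ne v u with rfl | hvu
    · have : ∀ γ, g v v γ = 0 := by
        intro γ
        simp only [g]
        split_ifs with h
        · rw [sqExcess_eq_zero_iff.2 (by omega), Nat.cast_zero]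
        · rfl
      simp [this]
    · exact P.lintegral_matched_ge hF hfair t hvu _
  have hdrop : ∀ ω, 2 * (potential m (affineLoad σ d (P.Γ (t + 2) ω)) : ENNReal) +
      ∑ v, ∑ u, {ω | s(v, u) ∈ P.M (t + 1) ω}.indicator (fun ω => g v u (P.Γ (t + 1) ω)) ω ≤
      2 * (potential m (x ω) : ENNReal) := by
    intro ω
    have h := (P.isBalancingStep hσ d (t + 1) ω).potential_drop m
    have h' : ((2 * potential m (affineLoad σ d (P.Γ (t + 2) ω)) +
        ∑ v, ∑ u, (if x ω u ≤ m ∧ s(v, u) ∈ P.M (t + 1) ω then sqExcess m (x ω v) else 0) : ℕ) :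
          ENNReal) ≤ ((2 * potential m (x ω) : ℕ) : ENNReal) := by
      exact_mod_cast h
    push_cast at h'
    refine le_of_eq_of_le ?_ h'
    congr 1
    refine Finset.sum_congr rfl fun v _ => Finset.sum_congr rfl fun u _ => ?_
    simp only [Set.indicator_apply, Set.mem_ofPred_eq, g, x]
    split_ifs <;> first | rfl | tauto
  have hcount : ∀ ω, (Fintype.card V : ENNReal) * potential m (x ω) ≤
      4 * ∑ v, ∑ u, g v u (P.Γ (t + 1) ω) := by
    intro ω
    have h1 : ∀ v, ∑ u, g v u (P.Γ (t + 1) ω) =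
        (#{u | x ω u ≤ m} : ENNReal) * sqExcess m (x ω v) := by
      intro v
      simp only [g, x]
      rw [← Finset.sum_filter, Finset.sum_const, nsmul_eq_mul]
    simp only [h1]
    rw [← Finset.mul_sum, ← mul_assoc, potential, Nat.cast_sum]
    gcongr
    exact_mod_cast hlight ω
  have hI := lintegral_mono (μ := P.μ) hdrop
  rw [lintegral_add_left ((hmeas (t + 2) fun γ => potential m (affineLoad σ d γ)).const_mul 2),
    lintegral_const_mul _ (hmeas (t + 2) fun γ => potential m (affineLoad σ d γ)),
    lintegral_const_mul _ (hmeas (t + 1) fun γ => potential m (affineLoad σ d γ)),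
    lintegral_finsetSum _ fun v _ => Finset.measurable_sum _ fun u _ =>
      (hmeas _ _).indicator (P.measurableSet_edge _ _)] at hI
  have hC := lintegral_mono (μ := P.μ) hcount
  rw [lintegral_const_mul _ (hmeas (t + 1) fun γ => potential m (affineLoad σ d γ)),
    lintegral_const_mul _ (hmeas (t + 1) fun γ => ∑ v, ∑ u, g v u γ),
    lintegral_finsetSum _ fun v _ => hmeas _ fun γ => ∑ u, g v u γ] at hC
  have hS : κ * ∑ v, ∫⁻ ω, ∑ u, g v u (P.Γ (t + 1) ω) ∂P.μ ≤
      ∑ v, ∫⁻ ω, ∑ u, {ω | s(v, u) ∈ P.M (t + 1) ω}.indicator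
        (fun ω => g v u (P.Γ (t + 1) ω)) ω ∂P.μ := by
    rw [Finset.mul_sum]
    refine Finset.sum_le_sum fun v _ => ?_
    rw [lintegral_finsetSum _ fun u _ => hmeas _ _,
      lintegral_finsetSum _ fun u _ => (hmeas _ _).indicator (P.measurableSet_edge _ _),
      Finset.mul_sum]
    exact Finset.sum_le_sum fun u _ => hpair v u
  calc _ ≤ 8 * ∫⁻ ω, (potential m (affineLoad σ d (P.Γ (t + 2) ω)) : ENNReal) ∂P.μ +
        κ * (4 * ∑ v, ∫⁻ ω, ∑ u, g v u (P.Γ (t + 1) ω) ∂P.μ) := by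
        rw [mul_assoc]
        gcongr
    _ = 4 * (2 * ∫⁻ ω, (potential m (affineLoad σ d (P.Γ (t + 2) ω)) : ENNReal) ∂P.μ +
        κ * ∑ v, ∫⁻ ω, ∑ u, g v u (P.Γ (t + 1) ω) ∂P.μ) := by ring
    _ ≤ 4 * (2 * ∫⁻ ω, (potential m (x ω) : ENNReal) ∂P.μ) := by
        gcongr
        exact le_trans (by gcongr) hI
    _ = _ := by ring

lemma card_mul_matchProb_le {F : ℝ} (hF1 : F ≤ 1) :
    P.matchProb F * Fintype.card V ≤ 1 := by
  have h1 := P.minProb_pos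
  have h2 := P.minProb_le_maxProb
  have h3 := P.maxProb_pos
  have hn : (0 : ℝ) ≤ Fintype.card V := Nat.cast_nonneg _
  rw [matchProb, div_mul_eq_mul_div, div_le_one (by positivity)]
  nlinarith [mul_le_mul hF1 h2 h1.le zero_le_one, mul_nonneg hn h3.le]

/-- If the loads are at least `m - 1` and exceed `m` by at most `1/2` on average, then they are
at most `m + 1` at time `k + 1`, with a failure probability decaying geometrically in `k`. -/
lemma prob_le_level {F : ℝ} (hF0 : 0 ≤ F) (hF1 : F ≤ 1) (hfair : P.Fair F) {σ : ℤ}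
    (hσ : σ = 1 ∨ σ = -1) (d m : ℤ) {Γ₀ : V → ℕ} (h0 : ∀ ω, P.Γ 0 ω = Γ₀)
    (hmin : ∀ v, m - 1 ≤ affineLoad σ d Γ₀ v)
    (hsum : 2 * ∑ v, (affineLoad σ d Γ₀ v - m) ≤ Fintype.card V) (k : ℕ) :
    ENNReal.ofReal (1 - (1 - P.matchProb F * Fintype.card V / 8) ^ k *
        potential m (affineLoad σ d Γ₀)) ≤
      P.μ {ω | ∀ v, affineLoad σ d (P.Γ (k + 1) ω) v ≤ m + 1} := by
  have hm : ∀ t, Measurable (P.Γ t) := fun t => (P.measurable_loads t).mono (P.hist_le _) le_rfl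
  have hmeas : ∀ t, Measurable fun ω =>
      (potential m (affineLoad σ d (P.Γ t ω)) : ENNReal) := fun t =>
    (Measurable.of_discrete (f := fun γ => (potential m (affineLoad σ d γ) : ENNReal))).comp (hm t)
  set C := potential m (affineLoad σ d Γ₀)
  set ρ := P.matchProb F * Fintype.card V / 8 with hρ
  set L : ℕ → ENNReal := fun t =>
    ∫⁻ ω, (potential m (affineLoad σ d (P.Γ t ω)) : ENNReal) ∂P.μ with hL
  have hLC : ∀ t, L t ≤ C := by
    intro t
    refine (lintegral_mono (g := fun _ => (C : ENNReal)) fun ω => ?_).trans (by simp)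
    have := P.potential_le_initial hσ d m t ω
    rw [h0] at this
    exact Nat.cast_le.2 this
  have hfin : ∀ t, L t ≠ ⊤ := fun t => ((hLC t).trans_lt (ENNReal.natCast_lt_top C)).ne
  have hκ := P.matchProb_nonneg hF0
  have hρ1 : 0 ≤ 1 - ρ := by
    have := P.card_mul_matchProb_le hF1
    rw [hρ]
    linarith
  have hstep : ∀ t, (L (t + 2)).toReal ≤ (1 - ρ) * (L (t + 1)).toReal := by
    intro t
    have h := P.lintegral_potential_drift hF0 hfair hσ d m t fun ω =>
      P.card_le_four_mul_card_light hσ d m ω (by simpa only [h0] using hmin)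
        (by simpa only [h0] using hsum) (t + 1)
    have h' := ENNReal.toReal_mono (ENNReal.mul_ne_top (by norm_num) (hfin (t + 1))) h
    rw [ENNReal.toReal_add (ENNReal.mul_ne_top (by norm_num) (hfin (t + 2)))
      (ENNReal.mul_ne_top (ENNReal.mul_ne_top ENNReal.ofReal_ne_top (ENNReal.natCast_ne_top _))
        (hfin (t + 1)))] at h'
    simp only [ENNReal.toReal_mul, ENNReal.toReal_ofReal hκ, ENNReal.toReal_natCast,
      ENNReal.toReal_ofNat] at h'
    rw [hρ]
    linarith
  have hgeom : (L (k + 1)).toReal ≤ (1 - ρ) ^ k * C := by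
    induction k with
    | zero =>
      rw [pow_zero, one_mul, ← ENNReal.toReal_natCast]
      exact ENNReal.toReal_mono (ENNReal.natCast_ne_top C) (hLC 1)
    | succ k ih =>
      calc _ ≤ (1 - ρ) * (L (k + 1)).toReal := hstep k
        _ ≤ (1 - ρ) * ((1 - ρ) ^ k * C) := mul_le_mul_of_nonneg_left ih hρ1
        _ = _ := by ring
  have hgood : {ω | ∀ v, affineLoad σ d (P.Γ (k + 1) ω) v ≤ m + 1} =
      {ω | 1 ≤ (potential m (affineLoad σ d (P.Γ (k + 1) ω)) : ENNReal)}ᶜ := by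
    ext ω
    simp only [Set.mem_ofPred_eq, Set.mem_compl_iff, Nat.one_le_cast, not_le, Nat.lt_one_iff,
      potential, Finset.sum_eq_zero_iff, Finset.mem_univ, true_implies, sqExcess_eq_zero_iff]
  have hmarkov : P.μ {ω | 1 ≤ (potential m (affineLoad σ d (P.Γ (k + 1) ω)) : ENNReal)} ≤
      ENNReal.ofReal ((1 - ρ) ^ k * C) := by
    have := mul_meas_ge_le_lintegral₀ (μ := P.μ) (hmeas (k + 1)).aemeasurable 1
    rw [one_mul] at this
    exact this.trans ((ENNReal.le_ofReal_iff_toReal_le (hfin (k + 1)) (by positivity)).2 hgeom)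
  rw [hgood, prob_compl_eq_one_sub (measurableSet_le measurable_const (hmeas (k + 1))),
    ENNReal.ofReal_sub _ (by positivity), ENNReal.ofReal_one]
  exact tsub_le_tsub_left hmarkov _

lemma cstar_pos {θ : ℝ} (hθ : 0 < θ) : 0 < cstar θ := by
  have : Real.exp (-θ / 3) < 1 := Real.exp_lt_one_iff.2 (by linarith)
  have : 0 < 1 - Real.exp (-θ / 3) := by linarith
  unfold cstar
  positivity

lemma cstar_le {θ : ℝ} (hθ : 0 < θ) : cstar θ ≤ θ / (1 + θ) := by
  have h1 : Real.exp (-θ / 3) < 1 := Real.exp_lt_one_iff.2 (by linarith)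
  have h2 := Real.exp_pos (-θ / 3)
  have h3 : (1 - Real.exp (-θ / 3)) ^ 2 ≤ 1 := by nlinarith
  calc cstar θ ≤ 1 / (1 + 1 / θ) := by
        unfold cstar
        gcongr
        norm_num
    _ = θ / (1 + θ) := by
        field_simp
        ring

/-- The drift of the potential exceeds `c_* F / (16 r)`. -/
lemma cstar_mul_le_drift {F θ : ℝ} (hF : 0 < F) (hθ : 0 < θ) [Nonempty V]
    (hθn : θ / (Fintype.card V : ℝ) ≤ P.maxProb) :
    cstar θ * F / (16 * P.r) ≤ P.matchProb F * Fintype.card V / 8 := by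
  have hs := P.minProb_pos
  have hb := P.maxProb_pos
  have hn : (0 : ℝ) < Fintype.card V := Nat.cast_pos.2 Fintype.card_pos
  have hnb : θ ≤ P.maxProb * Fintype.card V := (div_le_iff₀ hn).1 hθn
  have h1 : cstar θ ≤ P.maxProb * Fintype.card V / (1 + P.maxProb * Fintype.card V) := by
    refine (cstar_le hθ).trans ?_
    rw [div_le_div_iff₀ (by positivity) (by positivity)]
    linarith
  rw [P.r_eq]
  calc _ ≤ P.maxProb * Fintype.card V / (1 + P.maxProb * Fintype.card V) * F /
        (16 * (P.maxProb / P.minProb)) := by gcongr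
    _ = _ := by
        unfold matchProb
        field_simp
        ring

lemma one_le_r : 1 ≤ P.r := by
  rw [P.r_eq, one_le_div P.minProb_pos]
  exact P.minProb_le_maxProb

lemma pow_mul_le_sq {F θ ε D : ℝ} (hF0 : 0 < F) (hF1 : F ≤ 1) (hθ : 0 < θ) [Nonempty V]
    (hθn : θ / (Fintype.card V : ℝ) ≤ P.maxProb) (hε0 : 0 < ε) (hε1 : ε < 1 / 4) (hD : 2 ≤ D)
    {T : ℕ} (hT : 54 * P.r / (cstar θ * F) * Real.log (D * (Fintype.card V : ℝ) / ε) ≤ T) :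
    ∃ k, T = k + 1 ∧
      (1 - P.matchProb F * Fintype.card V / 8) ^ k * (Fintype.card V * D ^ 2) ≤ ε ^ 2 := by
  have hc := cstar_pos hθ
  have hc1 : cstar θ ≤ 1 := (cstar_le hθ).trans ((div_le_one (by positivity)).2 (by linarith))
  have hr := P.one_le_r
  have hn : (1 : ℝ) ≤ Fintype.card V := Nat.one_le_cast.2 Fintype.card_pos
  have hdrift := P.cstar_mul_le_drift hF0 hθ hθn
  have hdrift1 := P.card_mul_matchProb_le hF1
  set n := (Fintype.card V : ℝ)
  set ρ := P.matchProb F * n / 8 with hρ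
  set l := Real.log (D * n / ε) with hl
  set Q := P.r / (cstar θ * F) with hQ
  have hQ1 : 1 ≤ Q := by
    rw [hQ, one_le_div (by positivity)]
    nlinarith
  have hl1 : 1 ≤ l := by
    rw [hl, Real.le_log_iff_exp_le (by positivity)]
    have h1 : 4 ≤ D * n / ε := by
      rw [le_div_iff₀ hε0]
      nlinarith
    linarith [Real.exp_one_lt_d9]
  have hT' : 54 * Q * l ≤ T := by
    rw [hQ, ← mul_div_assoc]
    exact hT
  have hρQ : 1 / (16 * Q) ≤ ρ := by
    refine le_of_eq_of_le ?_ hdrift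
    rw [hQ]
    field_simp
  have hT1 : (1 : ℝ) ≤ T := by nlinarith
  obtain ⟨k, rfl⟩ := Nat.exists_eq_add_of_le' (show 1 ≤ T by exact_mod_cast hT1)
  refine ⟨k, rfl, ?_⟩
  push_cast at hT'
  have hk : 2 * l ≤ k * ρ := by
    have h1 : 32 * Q * l ≤ k := by nlinarith
    calc 2 * l = 32 * Q * l * (1 / (16 * Q)) := by
          field_simp
          ring
      _ ≤ k * ρ := by gcongr
  have hpow : (1 - ρ) ^ k ≤ (ε / (D * n)) ^ 2 := by
    calc (1 - ρ) ^ k ≤ Real.exp (-ρ) ^ k :=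
          pow_le_pow_left₀ (by rw [hρ]; linarith) (Real.one_sub_le_exp_neg ρ) k
      _ = Real.exp (-(k * ρ)) := by
          rw [← Real.exp_nat_mul]
          ring_nf
      _ ≤ Real.exp (-(2 * l)) := Real.exp_le_exp.2 (by linarith)
      _ = (ε / (D * n)) ^ 2 := by
          rw [show -(2 * l) = ((2 : ℕ) : ℝ) * (-l) by push_cast; ring, Real.exp_nat_mul,
            Real.exp_neg, hl, Real.exp_log (by positivity), inv_div]
  calc _ ≤ (ε / (D * n)) ^ 2 * (n * D ^ 2) := by gcongr
    _ = ε ^ 2 / n := by field_simp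
    _ ≤ ε ^ 2 := div_le_self (by positivity) hn

lemma prob_le_roundNear [Nonempty V] {F θ ε : ℝ} (hF0 : 0 < F) (hF1 : F ≤ 1) (hfair : P.Fair F)
    (hθ : 0 < θ) (hθn : θ / (Fintype.card V : ℝ) ≤ P.maxProb) {Γ₀ : V → ℕ}
    (h0 : ∀ ω, P.Γ 0 ω = Γ₀) (hΔ : 2 ≤ disc Γ₀) (hε0 : 0 < ε) (hε1 : ε < 1 / 4) {T : ℕ}
    (hT : 54 * P.r / (cstar θ * F) *
      Real.log ((disc Γ₀ : ℝ) * (Fintype.card V : ℝ) / ε) ≤ (T : ℝ))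
    {σ : ℤ} (hσ : σ = 1 ∨ σ = -1) (d : ℤ) {A : ℝ}
    (hA : ∑ v, (affineLoad σ d Γ₀ v : ℝ) = Fintype.card V * A)
    (hmin : ∀ v, A - 1 ≤ affineLoad σ d Γ₀ v) :
    ENNReal.ofReal (1 - ε ^ 2) ≤
      P.μ {ω | ∀ v, affineLoad σ d (P.Γ T ω) v ≤ roundNear A + 1} := by
  obtain ⟨k, rfl, hk⟩ := P.pow_mul_le_sq hF0 hF1 hθ hθn hε0 hε1 (by exact_mod_cast hΔ) hT
  set m := roundNear A
  have hm1 : A - 1 / 2 ≤ m := Int.le_ceil _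
  have hm2 : (m : ℝ) < A - 1 / 2 + 1 := Int.ceil_lt_add_one _
  have hn : (0 : ℝ) < Fintype.card V := Nat.cast_pos.2 Fintype.card_pos
  have hmin' : ∀ v, m - 1 ≤ affineLoad σ d Γ₀ v := by
    intro v
    have h1 : ((m - 2 : ℤ) : ℝ) < affineLoad σ d Γ₀ v := by
      push_cast
      linarith [hmin v]
    have h2 : m - 2 < affineLoad σ d Γ₀ v := by exact_mod_cast h1
    omega
  have hsum : 2 * ∑ v, (affineLoad σ d Γ₀ v - m) ≤ Fintype.card V := by
    have h1 : 2 * ∑ v, ((affineLoad σ d Γ₀ v : ℝ) - m) ≤ Fintype.card V := by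
      rw [Finset.sum_sub_distrib, hA, Finset.sum_const, Finset.card_univ, nsmul_eq_mul]
      nlinarith
    exact_mod_cast h1
  have hdev : ∀ v, affineLoad σ d Γ₀ v - m - 1 ≤ disc Γ₀ := by
    intro v
    have h1 : ∀ w, affineLoad σ d Γ₀ v - disc Γ₀ ≤ affineLoad σ d Γ₀ w := by
      intro w
      have h2 := sub_le_disc Γ₀ v w
      have h3 := sub_le_disc Γ₀ w v
      simp only [affineLoad]
      rcases hσ with rfl | rfl <;> omega
    have h2 : ∑ _w : V, ((affineLoad σ d Γ₀ v : ℝ) - disc Γ₀) ≤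
        ∑ w, (affineLoad σ d Γ₀ w : ℝ) :=
      Finset.sum_le_sum fun w _ => by exact_mod_cast h1 w
    rw [hA, Finset.sum_const, Finset.card_univ, nsmul_eq_mul] at h2
    have h3 := le_of_mul_le_mul_left h2 hn
    have h4 : ((affineLoad σ d Γ₀ v - m - 1 : ℤ) : ℝ) ≤ ((disc Γ₀ : ℤ) : ℝ) := by
      push_cast
      linarith
    exact_mod_cast h4
  have hpot : (potential m (affineLoad σ d Γ₀) : ℝ) ≤ Fintype.card V * (disc Γ₀ : ℝ) ^ 2 := by
    have h1 : potential m (affineLoad σ d Γ₀) ≤ ∑ _v : V, disc Γ₀ ^ 2 :=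
      Finset.sum_le_sum fun v _ => Nat.pow_le_pow_left (Int.toNat_le.2 (hdev v)) 2
    rw [Finset.sum_const, Finset.card_univ, smul_eq_mul] at h1
    exact_mod_cast h1
  refine le_trans (ENNReal.ofReal_le_ofReal ?_)
    (P.prob_le_level hF0.le hF1 hfair hσ d m h0 hmin' hsum k)
  have hbase : 0 ≤ 1 - P.matchProb F * Fintype.card V / 8 := by
    linarith [P.card_mul_matchProb_le hF1]
  have := mul_le_mul_of_nonneg_left hpot (pow_nonneg hbase k)
  linarith

end EMLoadProcess

/-- **Phase II (Lemma `PhaseII`).**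
Suppose `p ∈ (0,1]` and `q ∈ [0,1)` satisfy `max{p, 1−q} ≥ θ/n` for a constant `θ > 0`, and
consider a random matching algorithm satisfying the `F`-fair condition on an edge-Markovian
evolving graph with parameters `p, q`, started from configuration `Γ₀` of discrepancy
`Δ ≥ 2`.  Let `0 < ε < 1/4` and let `T₂` be an integer with
`T₂ ≥ (54·r/(c_*·F))·log(Δ·n/ε)`.  Then:
(i) if `min_v Γ₀(v) ≥ μ − 1` then `Pr[max_v Γ_{T₂}(v) ≤ ⌈μ⌋ + 1] ≥ 1 − ε²`; and
(ii) if `min_v Γ̄₀(v) ≥ μ̄ − 1` (where `Γ̄_t(v) := K − Γ_t(v)`, `μ̄ := K − μ`) then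
`Pr[max_v Γ̄_{T₂}(v) ≤ ⌈μ̄⌋ + 1] ≥ 1 − ε²`. -/
theorem phase_two {V : Type} [Fintype V] [DecidableEq V] [Nonempty V]
    (θ : ℝ) (hθ : 0 < θ) (P : EMLoadProcess V)
    (hθn : θ / (Fintype.card V : ℝ) ≤ max P.p (1 - P.q))
    (F : ℝ) (hF0 : 0 < F) (hF1 : F ≤ 1) (hfair : P.Fair F)
    (Γ₀ : V → ℕ) (h0 : ∀ ω, P.Γ 0 ω = Γ₀) (hΔ : 2 ≤ disc Γ₀)
    (ε : ℝ) (hε0 : 0 < ε) (hε1 : ε < 1 / 4) (T₂ : ℕ)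
    (hT₂ : 54 * P.r / (cstar θ * F) *
        Real.log ((disc Γ₀ : ℝ) * (Fintype.card V : ℝ) / ε) ≤ (T₂ : ℝ)) :
    ((∀ v : V, avgLoad Γ₀ - 1 ≤ (Γ₀ v : ℝ)) →
      ENNReal.ofReal (1 - ε ^ 2) ≤
        P.μ {ω | ∀ v : V, (P.Γ T₂ ω v : ℤ) ≤ roundNear (avgLoad Γ₀) + 1}) ∧
    ((∀ v : V, (((∑ u : V, Γ₀ u : ℕ) : ℝ) - avgLoad Γ₀) - 1 ≤
        ((∑ u : V, Γ₀ u : ℕ) : ℝ) - (Γ₀ v : ℝ)) →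
      ENNReal.ofReal (1 - ε ^ 2) ≤
        P.μ {ω | ∀ v : V, ((∑ u : V, Γ₀ u : ℕ) : ℤ) - (P.Γ T₂ ω v : ℤ) ≤
          roundNear ((((∑ u : V, Γ₀ u : ℕ) : ℝ)) - avgLoad Γ₀) + 1}) := by
  have hn : (Fintype.card V : ℝ) ≠ 0 := Nat.cast_ne_zero.2 Fintype.card_ne_zero
  have hsum : ∑ v : V, (Γ₀ v : ℝ) = Fintype.card V * avgLoad Γ₀ := by
    rw [avgLoad, mul_div_cancel₀ _ hn]
  refine ⟨fun hmin => ?_, fun hmin => ?_⟩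
  · have h := P.prob_le_roundNear hF0 hF1 hfair hθ hθn h0 hΔ hε0 hε1 hT₂ (Or.inl rfl) 0
      (A := avgLoad Γ₀) (by simpa [EMLoadProcess.affineLoad] using hsum)
      (by simpa [EMLoadProcess.affineLoad] using hmin)
    simpa [EMLoadProcess.affineLoad] using h
  · have h := P.prob_le_roundNear hF0 hF1 hfair hθ hθn h0 hΔ hε0 hε1 hT₂ (Or.inr rfl)
      ((∑ u : V, Γ₀ u : ℕ) : ℤ) (A := ((∑ u : V, Γ₀ u : ℕ) : ℝ) - avgLoad Γ₀)
      (by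
        simp only [EMLoadProcess.affineLoad]
        push_cast
        rw [Finset.sum_add_distrib, ← Finset.mul_sum, hsum, Finset.sum_const, Finset.card_univ,
          nsmul_eq_mul]
        ring)
      (fun v => by
        have := hmin v
        simp only [EMLoadProcess.affineLoad]
        push_cast at this ⊢
        linarith)
    refine h.trans_eq ?_
    congr 1
    ext ω
    simp only [EMLoadProcess.affineLoad, Set.mem_ofPred_eq, neg_one_mul, neg_add_eq_sub]

end
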